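/- arXiv:2010.00195 — 3 statements merged into one kernel-verified Lean document; each statement's English description precedes it below -/
import Mathlib

section
/- Let n, P, J be positive integers, let Σ ∈ ℂ^{n×n} be Hermitian positive semidefinite, let B ∈ ℂ^{P×n}, Γ ∈ ℂ^{J×n}, and let c > 0. Then the matrix BΣBᴴ + c·I_P is invertible, and the matrix D° = Γ Σ Bᴴ (BΣBᴴ + c·I_P)⁻¹ minimizes the functional f(D) = Tr[(DB − Γ) Σ (DB − Γ)ᴴ] + c·Tr(D Dᴴ) over all D ∈ ℂ^{J×P}; moreover the minimum value equals Tr[Γ Σ Γᴴ] − Tr[Γ Σ Bᴴ (BΣBᴴ + c·I_P)⁻¹ B Σ Γᴴ]. (This is the matrix form of Lemma 1: the digital filter minimizing the mean-squared error for a fixed analog combiner B, where c = 4γ²/(3b²) is the dithered-quantization noise variance and Γ is the LMMSE matrix.) -/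
open Matrix
open scoped ComplexOrder

namespace Matrix

variable {m n p : Type*} [Fintype n] [Fintype p] [DecidableEq p]

theorem PosSemidef.posDef_mul_mul_conjTranspose_add_smul_one
    {S : Matrix n n ℂ} (hS : S.PosSemidef) (B : Matrix p n ℂ) {c : ℝ} (hc : 0 < c) :
    (B * S * Bᴴ + (c : ℂ) • (1 : Matrix p p ℂ)).PosDef :=
  (PosDef.one.smul (Complex.zero_lt_real.mpr hc)).posSemidef_add
    (hS.mul_mul_conjTranspose_same B)

/-- Completing the square in the regularized quadratic functional of `D`. -/
theorem regularized_quadratic_eq_completed_square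
    {S : Matrix n n ℂ} (hS : S.IsHermitian) (B : Matrix p n ℂ) (Γ : Matrix m n ℂ) {c : ℂ}
    {M : Matrix p p ℂ} (hM : M = B * S * Bᴴ + c • (1 : Matrix p p ℂ))
    (hMh : M.IsHermitian) (hMu : IsUnit M) (D : Matrix m p ℂ) :
    (D * B - Γ) * S * (D * B - Γ)ᴴ + c • (D * Dᴴ) =
      (D - Γ * S * Bᴴ * M⁻¹) * M * (D - Γ * S * Bᴴ * M⁻¹)ᴴ +
        (Γ * S * Γᴴ - Γ * S * Bᴴ * M⁻¹ * B * S * Γᴴ) := by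
  have hdet : IsUnit M.det := (isUnit_iff_isUnit_det M).mp hMu
  have hleft : (D - Γ * S * Bᴴ * M⁻¹) * M = D * M - Γ * S * Bᴴ := by
    rw [Matrix.sub_mul, nonsing_inv_mul_cancel_right _ _ hdet]
  have hright : (D - Γ * S * Bᴴ * M⁻¹)ᴴ = Dᴴ - M⁻¹ * (B * S * Γᴴ) := by
    simp only [conjTranspose_sub, conjTranspose_mul, conjTranspose_conjTranspose,
      hMh.inv.eq, hS.eq, Matrix.mul_assoc]
  have hcross : D * M * (M⁻¹ * (B * S * Γᴴ)) = D * (B * S * Γᴴ) := by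
    rw [Matrix.mul_assoc, mul_nonsing_inv_cancel_left _ _ hdet]
  have hquad : D * M * Dᴴ = D * B * S * (D * B)ᴴ + c • (D * Dᴴ) := by
    simp only [hM, Matrix.mul_add, Matrix.add_mul, conjTranspose_mul, Matrix.mul_assoc,
      Matrix.mul_smul, Matrix.smul_mul, Matrix.one_mul]
  rw [hleft, hright, Matrix.mul_sub (D * M - _), Matrix.sub_mul (D * M), Matrix.sub_mul (D * M),
    hcross, hquad]
  simp only [conjTranspose_sub, conjTranspose_mul, Matrix.sub_mul, Matrix.mul_sub,
    Matrix.mul_assoc]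
  abel

end Matrix

/-- Lemma 1 (matrix form): the digital filter minimizing the MSE for a fixed
analog combiner `B`, with dithered-quantization noise variance `c = 4γ²/(3b²)`. -/
theorem stmt0 (n P J : ℕ) (hn : 0 < n) (hP : 0 < P) (hJ : 0 < J)
    (S : Matrix (Fin n) (Fin n) ℂ) (hS : S.PosSemidef)
    (B : Matrix (Fin P) (Fin n) ℂ) (Γ : Matrix (Fin J) (Fin n) ℂ)
    (c : ℝ) (hc : 0 < c) :
    let f : Matrix (Fin J) (Fin P) ℂ → ℝ := fun D =>
      ((D * B - Γ) * S * (D * B - Γ)ᴴ).trace.re + c * (D * Dᴴ).trace.re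
    let Dopt : Matrix (Fin J) (Fin P) ℂ :=
      Γ * S * Bᴴ * (B * S * Bᴴ + (c : ℂ) • (1 : Matrix (Fin P) (Fin P) ℂ))⁻¹
    IsUnit (B * S * Bᴴ + (c : ℂ) • (1 : Matrix (Fin P) (Fin P) ℂ)) ∧
    (∀ D : Matrix (Fin J) (Fin P) ℂ, f Dopt ≤ f D) ∧
    f Dopt = (Γ * S * Γᴴ).trace.re -
      (Γ * S * Bᴴ * (B * S * Bᴴ + (c : ℂ) • (1 : Matrix (Fin P) (Fin P) ℂ))⁻¹ *
        B * S * Γᴴ).trace.re := by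
  intro f Dopt
  have hM := hS.posDef_mul_mul_conjTranspose_add_smul_one B hc
  have hf : ∀ D, f D = ((D - Dopt) * (B * S * Bᴴ + (c : ℂ) • 1) * (D - Dopt)ᴴ).trace.re +
      ((Γ * S * Γᴴ).trace.re -
        (Γ * S * Bᴴ * (B * S * Bᴴ + (c : ℂ) • (1 : Matrix (Fin P) (Fin P) ℂ))⁻¹ *
          B * S * Γᴴ).trace.re) := by
    intro D
    have h := congrArg (fun A => A.trace.re) <|
      regularized_quadratic_eq_completed_square hS.isHermitian B Γ rfl hM.isHermitian hM.isUnit D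
    simpa only [trace_add, trace_sub, trace_smul, smul_eq_mul, Complex.add_re, Complex.sub_re,
      Complex.re_ofReal_mul] using h
  have hopt : f Dopt = (Γ * S * Γᴴ).trace.re -
      (Γ * S * Bᴴ * (B * S * Bᴴ + (c : ℂ) • (1 : Matrix (Fin P) (Fin P) ℂ))⁻¹ *
        B * S * Γᴴ).trace.re := by
    rw [hf, sub_self, Matrix.zero_mul, Matrix.zero_mul, trace_zero, Complex.zero_re, zero_add]
  refine ⟨hM.isUnit, fun D => ?_, hopt⟩
  rw [hopt, hf D]
  exact le_add_of_nonneg_left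
    (Complex.nonneg_iff.mp (hM.posSemidef.mul_mul_conjTranspose_same (D - Dopt)).trace_nonneg).1
end

section
/- Let r ≥ 1, let λ₁ ≥ λ₂ ≥ … ≥ λ_r ≥ 0 with λ₁ > 0, let κ > 0, and let ζ > 0 satisfy κ·Σ_{l=1}^r (ζλ_l − 1)⁺ = 1. Then for every x = (x₁,…,x_r) ∈ ℝ^r with x_l ≥ 0 and Σ_{l=1}^r x_l ≤ 1, it holds that Σ_{l=1}^r λ_l² · x_l/(x_l + κ) ≤ Σ_{l=1}^r λ_l² · (ζλ_l − 1)⁺/(1 + (ζλ_l − 1)⁺), and equality is attained at x_l = κ(ζλ_l − 1)⁺. (This is the scalar water-filling problem whose solution gives the optimal squared singular values (Λ°)²_{l,l} of the analog combiner in Theorems 1 and 2.) -/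
/-- Tangent-line bound for the concave map `y ↦ m ^ 2 * (y / (y + 1))` at the water level
`max (m - 1) 0`, with slope `1`. -/
theorem sq_mul_div_add_one_le_waterfill {m y : ℝ} (hm : 0 ≤ m) (hy : 0 ≤ y) :
    m ^ 2 * (y / (y + 1)) ≤
      m ^ 2 * (max (m - 1) 0 / (1 + max (m - 1) 0)) + (y - max (m - 1) 0) := by
  have hy1 : 0 < y + 1 := by linarith
  rcases le_total m 1 with h | h
  · rw [max_eq_right (by linarith), ← mul_div_assoc, div_le_iff₀ hy1]
    have hm2 : m ^ 2 ≤ 1 := pow_le_one₀ hm h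
    nlinarith [mul_le_mul_of_nonneg_right hm2 hy, mul_nonneg hy hy]
  · have hp : m ^ 2 * ((m - 1) / (1 + (m - 1))) = m * (m - 1) := by
      have : m ≠ 0 := by linarith
      rw [add_sub_cancel]
      field_simp
    rw [max_eq_left (by linarith), hp, ← mul_div_assoc, div_le_iff₀ hy1]
    nlinarith [sq_nonneg (y - (m - 1))]

/-- Scaled form of `sq_mul_div_add_one_le_waterfill`. -/
theorem sq_mul_div_add_le_waterfill {a x κ ζ : ℝ} (ha : 0 ≤ a) (hx : 0 ≤ x)
    (hκ : 0 < κ) (hζ : 0 < ζ) :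
    a ^ 2 * (x / (x + κ)) ≤
      a ^ 2 * (max (ζ * a - 1) 0 / (1 + max (ζ * a - 1) 0)) +
        (x / κ - max (ζ * a - 1) 0) / ζ ^ 2 := by
  have h := sq_mul_div_add_one_le_waterfill (mul_nonneg hζ.le ha) (div_nonneg hx hκ.le)
  have hxκ : x / κ / (x / κ + 1) = x / (x + κ) := by
    have : x + κ ≠ 0 := by positivity
    field_simp
  rw [hxκ] at h
  refine le_of_mul_le_mul_left ?_ (pow_pos hζ 2)
  rw [mul_add, mul_div_cancel₀ _ (pow_pos hζ 2).ne']
  linarith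


/-- The scalar water-filling problem whose solution gives the optimal squared
singular values of the analog combiner in Theorems 1 and 2. -/
theorem stmt5 (r : ℕ) (hr : 1 ≤ r) (lam : Fin r → ℝ)
    (hanti : Antitone lam) (hnn : ∀ l, 0 ≤ lam l) (hpos : 0 < lam ⟨0, hr⟩)
    (κ ζ : ℝ) (hκ : 0 < κ) (hζ : 0 < ζ)
    (hwf : κ * ∑ l, max (ζ * lam l - 1) 0 = 1) :
    (∀ x : Fin r → ℝ, (∀ l, 0 ≤ x l) → ∑ l, x l ≤ 1 →
      ∑ l, lam l ^ 2 * (x l / (x l + κ)) ≤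
        ∑ l, lam l ^ 2 * (max (ζ * lam l - 1) 0 / (1 + max (ζ * lam l - 1) 0))) ∧
    ∑ l, lam l ^ 2 *
        ((κ * max (ζ * lam l - 1) 0) / (κ * max (ζ * lam l - 1) 0 + κ)) =
      ∑ l, lam l ^ 2 * (max (ζ * lam l - 1) 0 / (1 + max (ζ * lam l - 1) 0)) := by
  refine ⟨fun x hx hsum => ?_, Finset.sum_congr rfl fun l _ => ?_⟩
  · have hbound := Finset.sum_le_sum fun l (_ : l ∈ Finset.univ) =>
      sq_mul_div_add_le_waterfill (hnn l) (hx l) hκ hζ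
    rw [Finset.sum_add_distrib, ← Finset.sum_div, Finset.sum_sub_distrib,
      ← Finset.sum_div] at hbound
    have hp : ∑ l, max (ζ * lam l - 1) 0 = 1 / κ := by
      rw [eq_div_iff hκ.ne', mul_comm, hwf]
    have hslack : ((∑ l, x l) / κ - ∑ l, max (ζ * lam l - 1) 0) / ζ ^ 2 ≤ 0 := by
      rw [hp, ← sub_div]
      exact div_nonpos_of_nonpos_of_nonneg
        (div_nonpos_of_nonpos_of_nonneg (by linarith) hκ.le) (by positivity)
    linarith
  · rw [← mul_add_one, mul_div_mul_left _ _ hκ.ne', add_comm (1 : ℝ)]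
end

section
/- Let F_L be the L×L unitary DFT matrix and F̄ = F_Lᴴ ⊗ I_P. Let B̄ = blkdiag(B₁,…,B_L) with B_i ∈ ℂ^{P×n_i} and let Σ = blkdiag(Σ₁,…,Σ_L) with each Σ_i ∈ ℂ^{n_i×n_i} Hermitian positive semidefinite. Then the minimum over all block diagonal unitary matrices Ū = blkdiag(U₁,…,U_L) (each U_i ∈ ℂ^{P×P} unitary) of max_{1≤j≤LP} (F̄ Ū B̄ Σ B̄ᴴ Ūᴴ F̄ᴴ)_{j,j} equals (1/(LP))·Σ_{i=1}^L Tr(B_i Σ_i B_iᴴ), and the minimum is attained. (This is the key lemma in Appendix B used to prove Theorem 2: the optimal block-unitary rotation equalizes the ADC input variances at the value of the average trace.) -/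
open Matrix
open scoped Kronecker ComplexOrder

/-- The size-`P` unitary DFT matrix: a unitary matrix whose entries all have squared modulus
`1 / P`. -/
theorem exists_mem_unitaryGroup_normSq_eq (P : ℕ) (hP : 0 < P) :
    ∃ W ∈ Matrix.unitaryGroup (Fin P) ℂ, ∀ i j, W i j * star (W i j) = 1 / (P : ℂ) := by
  have hP' : (P : ℂ) ≠ 0 := by exact_mod_cast hP.ne'
  have hω := Complex.isPrimitiveRoot_exp P hP.ne'
  set ω := Complex.exp (2 * Real.pi * Complex.I / P) with hωdef
  have hω0 : ω ≠ 0 := Complex.exp_ne_zero _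
  have hstar : star ω = ω⁻¹ := by
    have h1 : ‖ω‖ = 1 := hω.norm'_eq_one hP.ne'
    rw [Complex.inv_eq_conj h1]
    rfl
  have hsq : ((Real.sqrt P : ℝ) : ℂ) * (Real.sqrt P : ℝ) = P := by
    rw [← Complex.ofReal_mul, Real.mul_self_sqrt (Nat.cast_nonneg P), Complex.ofReal_natCast]
  have hentry : ∀ i j k : ℕ, ω ^ (i * k) / (Real.sqrt P : ℂ) *
      star (ω ^ (j * k) / (Real.sqrt P : ℂ)) = (ω ^ i * (ω ^ j)⁻¹) ^ k / P := by
    intro i j k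
    have hr : star ((Real.sqrt P : ℝ) : ℂ) = (Real.sqrt P : ℝ) := Complex.conj_ofReal _
    rw [star_div₀, star_pow, hstar, hr, div_mul_div_comm, hsq, mul_pow, ← pow_mul, inv_pow,
      inv_pow, ← pow_mul]
  refine ⟨Matrix.of fun i j : Fin P => ω ^ ((i : ℕ) * (j : ℕ)) / (Real.sqrt P : ℂ), ?_, ?_⟩
  · rw [Matrix.mem_unitaryGroup_iff]
    ext i j
    simp only [Matrix.mul_apply, Matrix.star_apply, Matrix.of_apply, hentry]
    rw [← Finset.sum_div, Fin.sum_univ_eq_sum_range (fun k => (ω ^ (i : ℕ) * (ω ^ (j : ℕ))⁻¹) ^ k)]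
    rcases eq_or_ne i j with rfl | hij
    · simp [hω0, hP']
    · rw [Matrix.one_apply_ne hij, div_eq_zero_iff]
      left
      set z := ω ^ (i : ℕ) * (ω ^ (j : ℕ))⁻¹ with hz
      have hz1 : z ≠ 1 := fun h => hij <| Fin.ext <| hω.pow_inj i.2 j.2 <| by
        rwa [hz, mul_inv_eq_one₀ (pow_ne_zero _ hω0)] at h
      have hzP : z ^ P = 1 := by
        rw [hz, mul_pow, inv_pow, ← pow_mul, ← pow_mul, mul_comm (i : ℕ), mul_comm (j : ℕ), pow_mul,
          pow_mul, hω.pow_eq_one]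
        simp
      have h := geom_sum_mul z P
      rw [hzP, sub_self] at h
      exact (mul_eq_zero.mp h).resolve_right (sub_ne_zero.mpr hz1)
  · intro i j
    simp only [Matrix.of_apply, hentry]
    simp [hω0]

/-- Every Hermitian matrix is unitarily conjugate to one with constant diagonal. -/
theorem Matrix.IsHermitian.exists_unitary_conj_diag_eq {P : ℕ} (hP : 0 < P)
    {A : Matrix (Fin P) (Fin P) ℂ} (hA : A.IsHermitian) :
    ∃ U ∈ Matrix.unitaryGroup (Fin P) ℂ, ∀ p, (U * A * Uᴴ) p p = A.trace / P := by
  obtain ⟨W, hW, hWe⟩ := exists_mem_unitaryGroup_normSq_eq P hP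
  let V : Matrix (Fin P) (Fin P) ℂ := hA.eigenvectorUnitary
  let D : Matrix (Fin P) (Fin P) ℂ := diagonal (RCLike.ofReal ∘ hA.eigenvalues)
  have hVV : Vᴴ * V = 1 := Matrix.mem_unitaryGroup_iff'.mp hA.eigenvectorUnitary.2
  have hAV : A = V * D * Vᴴ := by
    conv_lhs => rw [hA.spectral_theorem]
    rw [Unitary.conjStarAlgAut_apply]
    rfl
  refine ⟨W * Vᴴ, mul_mem hW (Unitary.star_mem hA.eigenvectorUnitary.2), fun p => ?_⟩
  have hconj : W * Vᴴ * A * (W * Vᴴ)ᴴ =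
      W * D * Wᴴ := by
    rw [conjTranspose_mul, conjTranspose_conjTranspose]
    calc _ = W * (Vᴴ * A * V) * Wᴴ := by simp only [Matrix.mul_assoc]
      _ = W * ((Vᴴ * V) * D * (Vᴴ * V)) * Wᴴ := by
        conv_lhs => rw [hAV]
        simp only [Matrix.mul_assoc]
      _ = _ := by rw [hVV, Matrix.one_mul, Matrix.mul_one]
  rw [hconj, hA.trace_eq_sum_eigenvalues, Finset.sum_div, Matrix.mul_apply]
  refine Finset.sum_congr rfl fun k _ => ?_
  rw [Matrix.mul_diagonal, conjTranspose_apply, mul_right_comm, hWe]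
  simp only [Function.comp_apply]
  exact one_div_mul_eq_div _ _

/-- Conjugating a block diagonal matrix by `Fᴴ ⊗ I`, with all entries of `F` of squared modulus
`1 / L`, averages the diagonals of the blocks. -/
theorem kronecker_one_conj_blockDiag_apply {L P : ℕ} {F : Matrix (Fin L) (Fin L) ℂ}
    (hF : ∀ j k, star (F j k) * F j k = 1 / (L : ℂ)) (C : Fin L → Matrix (Fin P) (Fin P) ℂ)
    (j : Fin L × Fin P) :
    ((Fᴴ ⊗ₖ (1 : Matrix (Fin P) (Fin P) ℂ)) *
      (Matrix.of fun p q : Fin L × Fin P => if p.1 = q.1 then C p.1 p.2 q.2 else 0) *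
      (Fᴴ ⊗ₖ (1 : Matrix (Fin P) (Fin P) ℂ))ᴴ) j j = (∑ i, C i j.2 j.2) / L := by
  obtain ⟨l, p⟩ := j
  simp only [Matrix.mul_apply, Fintype.sum_prod_type, kroneckerMap_apply, conjTranspose_apply,
    Matrix.one_apply, Matrix.of_apply, mul_ite, mul_one, mul_zero, ite_mul, zero_mul,
    Finset.sum_ite_irrel, Finset.sum_const_zero,
    Finset.sum_ite_eq, Finset.sum_ite_eq', Finset.mem_univ, if_true, star_star, apply_ite star,
    star_zero]
  rw [Finset.sum_div]
  refine Finset.sum_congr rfl fun i _ => ?_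
  rw [mul_right_comm, hF, one_div_mul_eq_div]

/-- The entries of the unitary DFT matrix have squared modulus `1 / L`. -/
theorem star_mul_self_dft_entry (L j k : ℕ) (z : ℂ)
    (hz : z = Complex.exp (-2 * (Real.pi : ℂ) * Complex.I * j * k / (L : ℂ)) /
      (Real.sqrt L : ℂ)) : star z * z = 1 / (L : ℂ) := by
  have hexp : ‖Complex.exp (-2 * (Real.pi : ℂ) * Complex.I * j * k / (L : ℂ))‖ = 1 := by
    have h : -2 * (Real.pi : ℂ) * Complex.I * j * k / (L : ℂ) =
        ((-2 * Real.pi * j * k / L : ℝ) : ℂ) * Complex.I := by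
      push_cast
      ring
    rw [h, Complex.norm_exp_ofReal_mul_I]
  have hnorm : ‖z‖ ^ 2 = 1 / (L : ℝ) := by
    rw [hz, norm_div, hexp, Complex.norm_real, Real.norm_of_nonneg (Real.sqrt_nonneg _), div_pow,
      Real.sq_sqrt (Nat.cast_nonneg L), one_pow]
  have h := Complex.conj_mul' z
  rw [← Complex.ofReal_pow, hnorm] at h
  simpa using h

/-- Key lemma of Appendix B used to prove Theorem 2: the minimum, over block
diagonal unitary matrices `Ū = blkdiag(U₁,…,U_L)`, of the maximal diagonal
entry of `F̄ Ū B̄ Σ B̄ᴴ Ūᴴ F̄ᴴ` equals the average trace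
`(1/(LP))·Σ_i Tr(B_i Σ_i B_iᴴ)`, and the minimum is attained. Here
`B̄ΣB̄ᴴ` is block diagonal with blocks `B_i Σ_i B_iᴴ`, so
`Ū B̄ Σ B̄ᴴ Ūᴴ` is block diagonal with blocks `U_i B_i Σ_i B_iᴴ U_iᴴ`. -/
theorem stmt11 (L P : ℕ) (hL : 0 < L) (hP : 0 < P) (nd : Fin L → ℕ)
    (F : Matrix (Fin L) (Fin L) ℂ)
    (hF : ∀ j k : Fin L, F j k =
      Complex.exp (-2 * (Real.pi : ℂ) * Complex.I * (j : ℕ) * (k : ℕ) / (L : ℂ)) /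
        (Real.sqrt L : ℂ))
    (Fbar : Matrix (Fin L × Fin P) (Fin L × Fin P) ℂ)
    (hFbar : Fbar = Fᴴ ⊗ₖ (1 : Matrix (Fin P) (Fin P) ℂ))
    (B : ∀ i : Fin L, Matrix (Fin P) (Fin (nd i)) ℂ)
    (S : ∀ i : Fin L, Matrix (Fin (nd i)) (Fin (nd i)) ℂ)
    (hS : ∀ i, (S i).PosSemidef) :
    IsLeast
      { r : ℝ | ∃ U : ∀ _ : Fin L, Matrix (Fin P) (Fin P) ℂ,
          (∀ i, U i ∈ Matrix.unitaryGroup (Fin P) ℂ) ∧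
          r = ⨆ j : Fin L × Fin P,
            ((Fbar *
              (Matrix.of fun p q : Fin L × Fin P =>
                if p.1 = q.1
                then (U p.1 * (B p.1 * S p.1 * (B p.1)ᴴ) * (U p.1)ᴴ) p.2 q.2
                else 0) * Fbarᴴ) j j).re }
      ((1 / ((L : ℝ) * (P : ℝ))) * ∑ i, (B i * S i * (B i)ᴴ).trace.re) := by
  have hL' : (L : ℝ) ≠ 0 := by exact_mod_cast hL.ne'
  have : Nonempty (Fin L × Fin P) := ⟨⟨⟨0, hL⟩, ⟨0, hP⟩⟩⟩
  have hF' : ∀ j k, star (F j k) * F j k = 1 / (L : ℂ) := fun j k =>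
    star_mul_self_dft_entry L j k _ (hF j k)
  subst hFbar
  have hre : ∀ z : ℂ, (z / (L : ℂ)).re = z.re / L := fun z => Complex.div_natCast_re z L
  constructor
  · choose U hU hdiag using fun i =>
      (isHermitian_mul_mul_conjTranspose (B i) (hS i).isHermitian).exists_unitary_conj_diag_eq hP
    refine ⟨U, hU, ?_⟩
    refine Eq.trans ?_ (iSup_congr fun j => congrArg Complex.re <|
      kronecker_one_conj_blockDiag_apply hF' (fun i => U i * (B i * S i * (B i)ᴴ) * (U i)ᴴ) j).symm
    simp only [hdiag, hre, Complex.re_sum, Complex.div_natCast_re, ciSup_const]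
    rw [← Finset.sum_div, div_div, one_div_mul_eq_div, mul_comm (L : ℝ)]
  · rintro r ⟨U, hU, rfl⟩
    refine le_of_le_of_eq ?_ (iSup_congr fun j => congrArg Complex.re <|
      kronecker_one_conj_blockDiag_apply hF' (fun i => U i * (B i * S i * (B i)ᴴ) * (U i)ᴴ) j).symm
    set f : Fin L × Fin P → ℝ := fun j =>
      ((∑ i, (U i * (B i * S i * (B i)ᴴ) * (U i)ᴴ) j.2 j.2) / (L : ℂ)).re with hf
    have hle : ∑ j, f j ≤ ∑ _j : Fin L × Fin P, ⨆ j, f j :=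
      Finset.sum_le_sum fun j _ => le_ciSup (Set.finite_range f).bddAbove j
    have htrace : ∀ i, (U i * (B i * S i * (B i)ᴴ) * (U i)ᴴ).trace =
        (B i * S i * (B i)ᴴ).trace := fun i => by
      have hUU : (U i)ᴴ * U i = 1 := Matrix.mem_unitaryGroup_iff'.mp (hU i)
      rw [Matrix.trace_mul_comm, ← Matrix.mul_assoc, hUU, Matrix.one_mul]
    have hsum : ∑ j, f j = ∑ i, (B i * S i * (B i)ᴴ).trace.re := by
      simp only [hf, hre, Fintype.sum_prod_type, Finset.sum_const, Finset.card_univ,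
        Fintype.card_fin, nsmul_eq_mul, ← Finset.sum_div]
      rw [mul_div_cancel_left₀ _ hL']
      simp only [Complex.re_sum]
      rw [Finset.sum_comm]
      refine Finset.sum_congr rfl fun i _ => ?_
      rw [← htrace, Matrix.trace, Complex.re_sum]
      rfl
    rw [hsum, Finset.sum_const, Finset.card_univ, Fintype.card_prod, Fintype.card_fin,
      Fintype.card_fin, nsmul_eq_mul, Nat.cast_mul] at hle
    rw [one_div_mul_eq_div, div_le_iff₀' (by positivity)]
    exact hle
end
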